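/- arXiv:2504.08302 — 2 statements merged into one kernel-verified Lean document; each statement's English description precedes it below -/
import Mathlib

section
/- Let A ∈ ℝ^{n×n} and C ∈ ℝ^{m×n} with the pair (A, C) observable (the only x ∈ ℝ^n with C A^k x = 0 for all integers k ≥ 0 is x = 0), let Q ∈ ℝ^{n×n} and R ∈ ℝ^{m×m} be positive definite, and let P be the unique positive definite solution of P = A(P⁻¹ + Cᵀ R⁻¹ C)⁻¹ Aᵀ + Q. Then for every ε > 0 there exists δ > 0 such that for every symmetric m×m matrix R' with ‖R' − R‖_F < δ, the matrix R' is positive definite and every positive definite solution P' of P' = A(P'⁻¹ + Cᵀ R'⁻¹ C)⁻¹ Aᵀ + Q satisfies ‖P' − P‖_F < ε. -/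
open Matrix

/-- The Frobenius norm of a real matrix. -/
noncomputable def frobNorm {a b : ℕ} (M : Matrix (Fin a) (Fin b) ℝ) : ℝ :=
  Real.sqrt (∑ i, ∑ j, (M i j) ^ 2)

open scoped MatrixOrder

namespace Matrix

variable {ι κ : Type*}

theorem smul_le_smul_of_le {M N : Matrix ι ι ℝ} (h : M ≤ N) {c : ℝ} (hc : 0 ≤ c) :
    c • M ≤ c • N := by
  rw [le_iff] at h ⊢
  simpa [smul_sub] using PosSemidef.smul h hc

theorem PosDef.smul_le_smul_left {M : Matrix ι ι ℝ} (hM : M.PosDef) {c d : ℝ} (h : c ≤ d) :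
    c • M ≤ d • M := by
  rw [le_iff, ← sub_smul]
  exact hM.posSemidef.smul (sub_nonneg.2 h)

variable [Fintype ι] [Fintype κ]

theorem IsHermitian.le_iff_dotProduct_mulVec {M N : Matrix ι ι ℝ} (hM : M.IsHermitian)
    (hN : N.IsHermitian) : M ≤ N ↔ ∀ x, x ⬝ᵥ M *ᵥ x ≤ x ⬝ᵥ N *ᵥ x := by
  rw [le_iff, posSemidef_iff_dotProduct_mulVec, and_iff_right (hN.sub hM)]
  simp [sub_mulVec, dotProduct_sub]

/-- Inversion is antitone on positive definite matrices. -/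
theorem PosDef.inv_le_inv [DecidableEq ι] {M N : Matrix ι ι ℝ} (hM : M.PosDef) (hN : N.PosDef)
    (h : M ≤ N) : N⁻¹ ≤ M⁻¹ := by
  let _ : Invertible N := hN.isUnit.invertible
  let _ : Invertible M⁻¹ := hM.inv.isUnit.invertible
  have hM' : IsUnit M.det := (isUnit_iff_isUnit_det M).1 hM.isUnit
  have h₁ := PosDef.fromBlocks₁₁ (1 : Matrix ι ι ℝ) M⁻¹ hN
  have h₂ := PosDef.fromBlocks₂₂ N (1 : Matrix ι ι ℝ) hM.inv
  simp only [conjTranspose_one, Matrix.one_mul, Matrix.mul_one,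
    nonsing_inv_nonsing_inv M hM'] at h₁ h₂
  exact h₁.1 (h₂.2 h)

theorem mul_mul_transpose_le {M N : Matrix ι ι ℝ} (h : M ≤ N) (B : Matrix κ ι ℝ) :
    B * M * Bᵀ ≤ B * N * Bᵀ := by
  rw [le_iff] at h ⊢
  simpa [Matrix.mul_sub, Matrix.sub_mul] using h.mul_mul_conjTranspose_same B

/-- Every quadratic form is dominated by a multiple of a given positive definite one. -/
theorem PosDef.exists_abs_dotProduct_mulVec_le {M : Matrix ι ι ℝ} (hM : M.PosDef)
    (N : Matrix ι ι ℝ) : ∃ c > 0, ∀ x, |x ⬝ᵥ N *ᵥ x| ≤ c * (x ⬝ᵥ M *ᵥ x) := by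
  have hpos : ∀ x : ι → ℝ, x ≠ 0 → 0 < x ⬝ᵥ M *ᵥ x := fun x hx => by
    simpa using hM.dotProduct_mulVec_pos hx
  have hcont : ∀ K : Matrix ι ι ℝ, Continuous fun x : ι → ℝ => x ⬝ᵥ K *ᵥ x := fun K => by
    fun_prop
  obtain ⟨c, hc⟩ := (isCompact_sphere (0 : ι → ℝ) 1).exists_bound_of_continuousOn
    (f := fun x => (x ⬝ᵥ N *ᵥ x) / (x ⬝ᵥ M *ᵥ x))
    ((hcont N).continuousOn.div (hcont M).continuousOn fun x hx =>
      (hpos x (ne_zero_of_mem_unit_sphere ⟨x, hx⟩)).ne')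
  refine ⟨max c 1, by positivity, fun x => ?_⟩
  rcases eq_or_ne x 0 with rfl | hx
  · simp
  have hmem : ‖x‖⁻¹ • x ∈ Metric.sphere (0 : ι → ℝ) 1 := by
    simp [norm_smul, hx]
  have hnx : ‖x‖ ≠ 0 := norm_ne_zero_iff.2 hx
  have := hc _ hmem
  simp only [mulVec_smul, dotProduct_smul, smul_dotProduct, smul_eq_mul] at this
  rw [mul_div_mul_left _ _ (inv_ne_zero hnx), mul_div_mul_left _ _ (inv_ne_zero hnx),
    Real.norm_eq_abs, abs_div, abs_of_pos (hpos x hx), div_le_iff₀ (hpos x hx)] at this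
  exact this.trans (mul_le_mul_of_nonneg_right (le_max_left _ _) (hpos x hx).le)

theorem PosDef.exists_le_smul {M : Matrix ι ι ℝ} (hM : M.PosDef) {N : Matrix ι ι ℝ}
    (hN : N.IsHermitian) : ∃ c > (0 : ℝ), N ≤ c • M := by
  obtain ⟨c, hc, h⟩ := hM.exists_abs_dotProduct_mulVec_le N
  refine ⟨c, hc, (hN.le_iff_dotProduct_mulVec (hM.smul hc).1).2 fun x => ?_⟩
  simpa [smul_mulVec] using (le_abs_self _).trans (h x)

theorem inv_smul_of_pos [DecidableEq ι] {M : Matrix ι ι ℝ} (hM : M.PosDef) {s : ℝ} (hs : 0 < s) :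
    (s • M)⁻¹ = s⁻¹ • M⁻¹ := by
  let _ := invertibleOfNonzero hs.ne'
  rw [inv_smul M s ((isUnit_iff_isUnit_det M).1 hM.isUnit), invOf_eq_inv]

variable [DecidableEq ι] [DecidableEq κ]

theorem PosDef.inv_add_transpose_mul_inv_mul {P : Matrix ι ι ℝ} (hP : P.PosDef)
    {R : Matrix κ κ ℝ} (hR : R.PosDef) (C : Matrix κ ι ℝ) : (P⁻¹ + Cᵀ * R⁻¹ * C).PosDef :=
  hP.inv.add_posSemidef (by simpa using hR.inv.posSemidef.conjTranspose_mul_mul_same C)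

/-- Comparison under one step of the Riccati map: the scaled solution gains the slack
`(s - 1) • Q`. -/
theorem dare_le_smul_sub {A : Matrix ι ι ℝ} {C : Matrix κ ι ℝ} {Q P P' : Matrix ι ι ℝ}
    {R R' : Matrix κ κ ℝ} (hR : R.PosDef) (hR' : R'.PosDef) (hP : P.PosDef) (hP' : P'.PosDef)
    (heq : P = A * (P⁻¹ + Cᵀ * R⁻¹ * C)⁻¹ * Aᵀ + Q)
    (heq' : P' = A * (P'⁻¹ + Cᵀ * R'⁻¹ * C)⁻¹ * Aᵀ + Q) {s : ℝ} (hs : 0 < s)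
    (hRR : R' ≤ s • R) (hPP : P' ≤ s • P) : P' ≤ s • P - (s - 1) • Q := by
  have h₁ := hP'.inv_le_inv (hP.smul hs) hPP
  have h₂ := mul_mul_transpose_le (hR'.inv_le_inv (hR.smul hs) hRR) Cᵀ
  rw [inv_smul_of_pos hP hs] at h₁
  rw [inv_smul_of_pos hR hs, transpose_transpose, Matrix.mul_smul, Matrix.smul_mul] at h₂
  have h₃ := add_le_add h₁ h₂
  rw [← smul_add] at h₃
  have hS := hP.inv_add_transpose_mul_inv_mul hR C
  have h₄ := mul_mul_transpose_le ((hS.smul (inv_pos.2 hs)).inv_le_inv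
    (hP'.inv_add_transpose_mul_inv_mul hR' C) h₃) A
  rw [inv_smul_of_pos hS (inv_pos.2 hs), inv_inv, Matrix.mul_smul, Matrix.smul_mul] at h₄
  calc P' = A * (P'⁻¹ + Cᵀ * R'⁻¹ * C)⁻¹ * Aᵀ + Q := heq'
    _ ≤ s • (A * (P⁻¹ + Cᵀ * R⁻¹ * C)⁻¹ * Aᵀ) + Q := by gcongr
    _ = s • (P - Q) + Q := by rw [← eq_sub_of_add_eq heq.symm]
    _ = s • P - (s - 1) • Q := by module

theorem dare_le_smul {A : Matrix ι ι ℝ} {C : Matrix κ ι ℝ} {Q P P' : Matrix ι ι ℝ}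
    {R R' : Matrix κ κ ℝ} (hQ : Q.PosDef) (hR : R.PosDef) (hR' : R'.PosDef) (hP : P.PosDef)
    (hP' : P'.PosDef) (heq : P = A * (P⁻¹ + Cᵀ * R⁻¹ * C)⁻¹ * Aᵀ + Q)
    (heq' : P' = A * (P'⁻¹ + Cᵀ * R'⁻¹ * C)⁻¹ * Aᵀ + Q) {t : ℝ} (ht : 1 < t)
    (hRR : R' ≤ t • R) : P' ≤ t • P := by
  obtain ⟨b, hb, hbP⟩ := hP.exists_le_smul hP'.1
  obtain ⟨d, hd, hdQ⟩ := hQ.exists_le_smul hP.1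
  set T : Set ℝ := {s | t ≤ s ∧ P' ≤ s • P} with hT
  have hne : T.Nonempty :=
    ⟨max t b, le_max_left _ _, hbP.trans (hP.smul_le_smul_left (le_max_right _ _))⟩
  have hbdd : BddBelow T := ⟨t, fun s hs => hs.1⟩
  have hclosed : IsClosed T := by
    have : T = Set.Ici t ∩ ⋂ x : ι → ℝ, {s : ℝ | x ⬝ᵥ P' *ᵥ x ≤ s * (x ⬝ᵥ P *ᵥ x)} := by
      ext s
      have hsP : (s • P).IsHermitian := by
        simp only [IsHermitian, conjTranspose_smul, hP.1.eq, star_trivial]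
      simp [hT, hP'.1.le_iff_dotProduct_mulVec hsP, smul_mulVec]
    rw [this]
    exact isClosed_Ici.inter (isClosed_iInter fun x =>
      isClosed_le continuous_const (by fun_prop))
  obtain ⟨hts, hs⟩ := hclosed.csInf_mem hne hbdd
  set s := sInf T
  rcases hts.eq_or_lt with h | h
  · rwa [h]
  have h1s : 0 < s - 1 := by linarith
  have hstep := dare_le_smul_sub hR hR' hP hP' heq heq' (by linarith)
    (hRR.trans (hR.smul_le_smul_left hts)) hs
  have hQP : (d⁻¹ * (s - 1)) • P ≤ (s - 1) • Q := by
    have := smul_le_smul_of_le hdQ (c := d⁻¹ * (s - 1)) (by positivity)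
    rwa [smul_smul, show d⁻¹ * (s - 1) * d = s - 1 by field_simp] at this
  have hlt : P' ≤ (s - d⁻¹ * (s - 1)) • P := by
    rw [sub_smul]
    exact hstep.trans (sub_le_sub_left hQP _)
  have hmem : max t (s - d⁻¹ * (s - 1)) ∈ T :=
    ⟨le_max_left _ _, hlt.trans (hP.smul_le_smul_left (le_max_right _ _))⟩
  have hle : s ≤ max t (s - d⁻¹ * (s - 1)) := csInf_le hbdd hmem
  have : max t (s - d⁻¹ * (s - 1)) < s := max_lt h (by
    have : 0 < d⁻¹ * (s - 1) := by positivity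
    linarith)
  exact absurd hle this.not_ge

end Matrix

section frobNorm

variable {a b : ℕ}

theorem abs_apply_le_frobNorm (M : Matrix (Fin a) (Fin b) ℝ) (i : Fin a) (j : Fin b) :
    |M i j| ≤ frobNorm M := by
  refine Real.abs_le_sqrt ?_
  calc M i j ^ 2 ≤ ∑ j, M i j ^ 2 :=
        Finset.single_le_sum (f := fun j => M i j ^ 2) (fun _ _ => sq_nonneg _) (Finset.mem_univ j)
    _ ≤ _ := Finset.single_le_sum (f := fun i => ∑ j, M i j ^ 2)
        (fun _ _ => Finset.sum_nonneg fun _ _ => sq_nonneg _) (Finset.mem_univ i)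

theorem frobNorm_le_sum_abs (M : Matrix (Fin a) (Fin b) ℝ) :
    frobNorm M ≤ ∑ i, ∑ j, |M i j| := by
  have h := Finset.sum_sq_le_sq_sum_of_nonneg (s := Finset.univ)
    (f := fun p : Fin a × Fin b => |M p.1 p.2|) (fun _ _ => abs_nonneg _)
  simp only [sq_abs, Fintype.sum_prod_type] at h
  exact (Real.sqrt_le_sqrt h).trans_eq
    (Real.sqrt_sq (Finset.sum_nonneg fun _ _ => Finset.sum_nonneg fun _ _ => abs_nonneg _))

theorem abs_dotProduct_mulVec_le_frobNorm (M : Matrix (Fin a) (Fin a) ℝ) (x : Fin a → ℝ) :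
    |x ⬝ᵥ M *ᵥ x| ≤ a * frobNorm M * (x ⬝ᵥ x) := by
  have h : ∀ i j, |x i * (M i j * x j)| ≤ frobNorm M * ((x i ^ 2 + x j ^ 2) / 2) := by
    intro i j
    rw [show x i * (M i j * x j) = M i j * (x i * x j) by ring, abs_mul]
    refine mul_le_mul (abs_apply_le_frobNorm M i j) ?_ (abs_nonneg _) (Real.sqrt_nonneg _)
    rw [abs_le]
    constructor <;> nlinarith [sq_nonneg (x i + x j), sq_nonneg (x i - x j)]
  calc |x ⬝ᵥ M *ᵥ x| = |∑ i, ∑ j, x i * (M i j * x j)| := by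
        simp [dotProduct, mulVec, Finset.mul_sum]
    _ ≤ ∑ i, ∑ j, |x i * (M i j * x j)| :=
        (Finset.abs_sum_le_sum_abs _ _).trans
          (Finset.sum_le_sum fun i _ => Finset.abs_sum_le_sum_abs _ _)
    _ ≤ ∑ i, ∑ j, frobNorm M * ((x i ^ 2 + x j ^ 2) / 2) :=
        Finset.sum_le_sum fun i _ => Finset.sum_le_sum fun j _ => h i j
    _ = a * frobNorm M * (x ⬝ᵥ x) := by
        simp only [← Finset.mul_sum, ← Finset.sum_div, Finset.sum_add_distrib, Finset.sum_const,
          Finset.card_univ, Fintype.card_fin, nsmul_eq_mul, dotProduct, ← pow_two]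
        ring

/-- A two-sided Loewner bound on a symmetric matrix bounds its entries, by polarization. -/
theorem Matrix.IsHermitian.abs_apply_le {D P : Matrix (Fin a) (Fin a) ℝ} (hD : D.IsHermitian)
    {c : ℝ} (h : ∀ x, |x ⬝ᵥ D *ᵥ x| ≤ c * (x ⬝ᵥ P *ᵥ x)) (i j : Fin a) :
    |D i j| ≤ c * ((P i i + P j j) / 2) := by
  have h₁ := abs_le.1 (h (Pi.single i 1 + Pi.single j 1))
  have h₂ := abs_le.1 (h (Pi.single i 1 - Pi.single j 1))
  have hs : D j i = D i j := by simpa using hD.apply i j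
  simp [mulVec_add, mulVec_sub, hs] at h₁ h₂
  rw [abs_le]
  constructor <;> nlinarith [h₁.1, h₁.2, h₂.1, h₂.2]

theorem exists_forall_smul_bounds_of_frobNorm_lt {R : Matrix (Fin a) (Fin a) ℝ} (hR : R.PosDef)
    {t : ℝ} (ht : 1 < t) : ∃ δ > (0 : ℝ), ∀ R' : Matrix (Fin a) (Fin a) ℝ, R'.IsSymm →
      frobNorm (R' - R) < δ → R'.PosDef ∧ R' ≤ t • R ∧ R ≤ t • R' := by
  obtain ⟨c, hc, hcR⟩ := hR.exists_abs_dotProduct_mulVec_le 1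
  have ht0 : 0 < t := by linarith
  have hη : 0 < 1 - t⁻¹ := sub_pos.2 (inv_lt_one_of_one_lt₀ ht)
  have hδ : 0 < (1 - t⁻¹) / ((a + 1) * c) := by positivity
  refine ⟨_, hδ, fun R' hsymm hlt => ?_⟩
  have hR' : R'.IsHermitian :=
    (conjTranspose_eq_transpose_of_trivial R').trans hsymm
  have hpos : ∀ x : Fin a → ℝ, 0 ≤ x ⬝ᵥ R *ᵥ x := fun x => by
    simpa using hR.posSemidef.dotProduct_mulVec_nonneg x
  have hbound : ∀ x, |x ⬝ᵥ R' *ᵥ x - x ⬝ᵥ R *ᵥ x| ≤ (1 - t⁻¹) * (x ⬝ᵥ R *ᵥ x) := by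
    intro x
    have h₁ := abs_dotProduct_mulVec_le_frobNorm (R' - R) x
    have h₂ := (le_abs_self _).trans (hcR x)
    rw [one_mulVec] at h₂
    rw [sub_mulVec, dotProduct_sub] at h₁
    have hF : 0 ≤ frobNorm (R' - R) := Real.sqrt_nonneg _
    rw [lt_div_iff₀ (by positivity)] at hlt
    calc _ ≤ a * frobNorm (R' - R) * (x ⬝ᵥ x) := h₁
      _ ≤ a * frobNorm (R' - R) * (c * (x ⬝ᵥ R *ᵥ x)) := by gcongr
      _ = (a * frobNorm (R' - R) * c) * (x ⬝ᵥ R *ᵥ x) := by ring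
      _ ≤ _ := mul_le_mul_of_nonneg_right (by nlinarith [mul_nonneg hF hc.le]) (hpos x)
  have hlow : ∀ x, t⁻¹ * (x ⬝ᵥ R *ᵥ x) ≤ x ⬝ᵥ R' *ᵥ x := fun x => by
    linarith [(abs_le.1 (hbound x)).1]
  have htt : 2 - t⁻¹ ≤ t := by
    have : t + t⁻¹ - 2 = (t - 1) ^ 2 / t := by field_simp; ring
    have : 0 ≤ (t - 1) ^ 2 / t := by positivity
    linarith
  have hPD : R'.PosDef := .of_dotProduct_mulVec_pos hR' fun x hx => by
    have := hR.dotProduct_mulVec_pos hx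
    rw [star_trivial] at this ⊢
    exact lt_of_lt_of_le (by positivity) (hlow x)
  refine ⟨hPD, (hR'.le_iff_dotProduct_mulVec (hR.smul ht0).1).2 fun x => ?_,
    (hR.1.le_iff_dotProduct_mulVec (hPD.smul ht0).1).2 fun x => ?_⟩
  · simp only [smul_mulVec, dotProduct_smul, smul_eq_mul]
    nlinarith [(abs_le.1 (hbound x)).2, hpos x]
  · simp only [smul_mulVec, dotProduct_smul, smul_eq_mul]
    rw [← inv_mul_le_iff₀ ht0]
    exact hlow x

theorem frobNorm_sub_le_of_le_smul {P P' : Matrix (Fin a) (Fin a) ℝ} (hP : P.PosDef)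
    (hP' : P'.PosDef) {t : ℝ} (ht : 1 < t) (h₁ : P' ≤ t • P) (h₂ : P ≤ t • P') :
    frobNorm (P' - P) ≤ (t - 1) * ∑ i, ∑ j, (P i i + P j j) / 2 := by
  have ht0 : 0 < t := by linarith
  rw [hP'.1.le_iff_dotProduct_mulVec (hP.smul ht0).1] at h₁
  rw [hP.1.le_iff_dotProduct_mulVec (hP'.smul ht0).1] at h₂
  have hbound : ∀ x, |x ⬝ᵥ (P' - P) *ᵥ x| ≤ (t - 1) * (x ⬝ᵥ P *ᵥ x) := fun x => by
    have hp : 0 ≤ x ⬝ᵥ P *ᵥ x := by simpa using hP.posSemidef.dotProduct_mulVec_nonneg x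
    have h₁ := h₁ x
    have h₂ := h₂ x
    simp only [smul_mulVec, dotProduct_smul, smul_eq_mul] at h₁ h₂
    rw [sub_mulVec, dotProduct_sub, abs_le]
    constructor
    · by_contra! hlt
      nlinarith [mul_nonneg (sq_nonneg (t - 1)) hp]
    · linarith
  refine (frobNorm_le_sum_abs _).trans ?_
  simp only [Finset.mul_sum]
  exact Finset.sum_le_sum fun i _ => Finset.sum_le_sum fun j _ =>
    (hP'.1.sub hP.1).abs_apply_le hbound i j

end frobNorm

/-- the positive definite solution of the information-form DARE
`P = A(P⁻¹ + Cᵀ R⁻¹ C)⁻¹ Aᵀ + Q` depends continuously on `R`: for every `ε > 0` there is a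
`δ > 0` such that every symmetric `R'` with `‖R' − R‖_F < δ` is positive definite and every
positive definite solution `P'` of the DARE with data `R'` satisfies `‖P' − P‖_F < ε`. -/
theorem dare_continuous_in_R {n m : ℕ}
    (A : Matrix (Fin n) (Fin n) ℝ) (C : Matrix (Fin m) (Fin n) ℝ)
    (hobs : ∀ x : Fin n → ℝ, (∀ k : ℕ, C.mulVec ((A ^ k).mulVec x) = 0) → x = 0)
    (Q : Matrix (Fin n) (Fin n) ℝ) (hQ : Q.PosDef)
    (R : Matrix (Fin m) (Fin m) ℝ) (hR : R.PosDef)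
    (P : Matrix (Fin n) (Fin n) ℝ) (hP : P.PosDef)
    (heq : P = A * (P⁻¹ + Cᵀ * R⁻¹ * C)⁻¹ * Aᵀ + Q) :
    ∀ ε > (0 : ℝ), ∃ δ > (0 : ℝ),
      ∀ R' : Matrix (Fin m) (Fin m) ℝ, R'.IsSymm → frobNorm (R' - R) < δ →
        R'.PosDef ∧
        ∀ P' : Matrix (Fin n) (Fin n) ℝ, P'.PosDef →
          P' = A * (P'⁻¹ + Cᵀ * R'⁻¹ * C)⁻¹ * Aᵀ + Q →
          frobNorm (P' - P) < ε := by
  intro ε hε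
  set K := ∑ i, ∑ j, (P i i + P j j) / 2
  have hK : 0 ≤ K := Finset.sum_nonneg fun i _ => Finset.sum_nonneg fun j _ => by
    have := hP.posSemidef.diag_nonneg (i := i)
    have := hP.posSemidef.diag_nonneg (i := j)
    positivity
  have ht : 1 < 1 + ε / (K + 1) := lt_add_of_pos_right _ (by positivity)
  obtain ⟨δ, hδ, h⟩ := exists_forall_smul_bounds_of_frobNorm_lt hR ht
  refine ⟨δ, hδ, fun R' hsymm hlt => ?_⟩
  obtain ⟨hR', hle, hge⟩ := h R' hsymm hlt
  refine ⟨hR', fun P' hP' heq' => ?_⟩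
  calc frobNorm (P' - P) ≤ (1 + ε / (K + 1) - 1) * K :=
        frobNorm_sub_le_of_le_smul hP hP' ht (dare_le_smul hQ hR hR' hP hP' heq heq' ht hle)
          (dare_le_smul hQ hR' hR hP' hP heq' heq ht hge)
    _ = ε * (K / (K + 1)) := by ring
    _ < ε := mul_lt_of_lt_one_right hε ((div_lt_one (by positivity)).2 (lt_add_one K))
end

section
/- Let A ∈ ℝ^{n×n} and C ∈ ℝ^{m×n} with the pair (A, C) observable (the only x ∈ ℝ^n with C A^k x = 0 for all integers k ≥ 0 is x = 0), let Q ∈ ℝ^{n×n} be positive definite, and let R_k (k ≥ 0) be a sequence of positive definite m×m matrices converging to a positive definite matrix R. Then for any positive definite initial value P_0, the iterates of the recursion P_{k+1} = A(P_k⁻¹ + Cᵀ R_k⁻¹ C)⁻¹ Aᵀ + Q converge to the unique positive definite solution P of the equation P = A(P⁻¹ + Cᵀ R⁻¹ C)⁻¹ Aᵀ + Q. -/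
open Matrix Filter

section LoewnerOrder

open scoped MatrixOrder

lemma Matrix.smul_le_smul_of_le_s14 {ι : Type*} {X Y : Matrix ι ι ℝ} (h : X ≤ Y) {t : ℝ} (ht : 0 ≤ t) :
    t • X ≤ t • Y := by
  rw [Matrix.le_iff] at h ⊢
  simpa [smul_sub] using h.smul ht

lemma Matrix.smul_le_smul_of_posSemidef {ι : Type*} {X : Matrix ι ι ℝ} (hX : X.PosSemidef) {s t : ℝ}
    (h : s ≤ t) : s • X ≤ t • X := by
  rw [Matrix.le_iff, ← sub_smul]
  exact hX.smul (sub_nonneg.mpr h)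

lemma Matrix.le_inv_smul_of_smul_le {ι : Type*} {X Y : Matrix ι ι ℝ} {s : ℝ} (hs : 0 < s)
    (h : s • X ≤ Y) : X ≤ s⁻¹ • Y := by
  simpa [smul_smul, hs.ne'] using Matrix.smul_le_smul_of_le_s14 h (inv_pos.mpr hs).le

variable {ι κ : Type*} [Fintype ι] [Fintype κ]

lemma Matrix.mul_mul_transpose_mono (B : Matrix κ ι ℝ) {X Y : Matrix ι ι ℝ} (h : X ≤ Y) :
    B * X * Bᵀ ≤ B * Y * Bᵀ := by
  rw [Matrix.le_iff] at h ⊢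
  simpa [Matrix.mul_sub, Matrix.sub_mul] using h.mul_mul_conjTranspose_same B

lemma Matrix.transpose_mul_mul_mono (B : Matrix ι κ ℝ) {X Y : Matrix ι ι ℝ} (h : X ≤ Y) :
    Bᵀ * X * B ≤ Bᵀ * Y * B := by
  simpa using Matrix.mul_mul_transpose_mono Bᵀ h

/-- Bounds in the Loewner order bound the entries. -/
lemma Matrix.abs_apply_le_of_loewner {D B : Matrix ι ι ℝ} (hD : D.IsHermitian)
    (hB : B.IsHermitian) (hl : -B ≤ D) (hu : D ≤ B) (i j : ι) :
    |D i j| ≤ (B i i + B j j) / 2 := by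
  classical
  have hDij : D j i = D i j := by simpa using hD.apply i j
  have hBij : B j i = B i j := by simpa using hB.apply i j
  rw [Matrix.le_iff] at hl hu
  have e (M : Matrix ι ι ℝ) (s : ℝ) :
      star (Pi.single i 1 + s • Pi.single j 1 : ι → ℝ) ⬝ᵥ
        (M *ᵥ (Pi.single i 1 + s • Pi.single j 1)) =
      M i i + s * M i j + s * M j i + s * s * M j j := by
    simp [mulVec_add, mulVec_smul, add_dotProduct, dotProduct_add]
    ring
  have h1 := hl.dotProduct_mulVec_nonneg (Pi.single i 1 + (1 : ℝ) • Pi.single j 1)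
  have h2 := hl.dotProduct_mulVec_nonneg (Pi.single i 1 + (-1 : ℝ) • Pi.single j 1)
  have h3 := hu.dotProduct_mulVec_nonneg (Pi.single i 1 + (1 : ℝ) • Pi.single j 1)
  have h4 := hu.dotProduct_mulVec_nonneg (Pi.single i 1 + (-1 : ℝ) • Pi.single j 1)
  rw [e] at h1 h2 h3 h4
  simp only [sub_apply, neg_apply] at h1 h2 h3 h4
  rw [abs_le]
  constructor <;> linarith

lemma Matrix.PosDef.eventually_isHermitian_imp_le {Y : Matrix ι ι ℝ} (hY : Y.PosDef) :
    ∀ᶠ D in nhds (0 : Matrix ι ι ℝ), D.IsHermitian → D ≤ Y := by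
  have key : ∀ᶠ D in nhds (0 : Matrix ι ι ℝ), ∀ x ∈ Metric.sphere (0 : ι → ℝ) 1,
      0 < x ⬝ᵥ ((Y - D) *ᵥ x) := by
    refine (isCompact_sphere _ _).eventually_forall_of_forall_eventually fun x hx => ?_
    have hc : Continuous fun z : Matrix ι ι ℝ × (ι → ℝ) => z.2 ⬝ᵥ ((Y - z.1) *ᵥ z.2) := by
      fun_prop
    refine hc.continuousAt.eventually_const_lt ?_
    have hx0 : x ≠ 0 := by
      rintro rfl
      simp at hx
    simpa using hY.dotProduct_mulVec_pos hx0
  filter_upwards [key] with D hD hDh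
  rw [Matrix.le_iff]
  refine .of_dotProduct_mulVec_nonneg (hY.isHermitian.sub hDh) fun x => ?_
  rcases eq_or_ne x 0 with rfl | hx
  · simp
  have h := hD (‖x‖⁻¹ • x) (by simp [norm_smul, hx])
  rw [mulVec_smul, smul_dotProduct, dotProduct_smul, smul_eq_mul, smul_eq_mul] at h
  have hn : 0 < ‖x‖⁻¹ := by positivity
  exact (pos_of_mul_pos_right (pos_of_mul_pos_right h hn.le) hn.le).le

lemma Matrix.PosDef.exists_pos_smul_le {X Y : Matrix ι ι ℝ} (hY : Y.PosDef)
    (hX : X.IsHermitian) : ∃ s : ℝ, 0 < s ∧ s < 1 ∧ s • X ≤ Y := by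
  have ht : Tendsto (fun s : ℝ => s • X) (nhdsWithin 0 (Set.Ioi 0)) (nhds 0) := by
    have : Tendsto (fun s : ℝ => s • X) (nhds 0) (nhds ((0 : ℝ) • X)) :=
      (continuous_id.smul continuous_const).tendsto 0
    rw [zero_smul] at this
    exact this.mono_left nhdsWithin_le_nhds
  obtain ⟨s, hs, hs'⟩ := ((ht.eventually hY.eventually_isHermitian_imp_le).and
    (Ioo_mem_nhdsGT (zero_lt_one' ℝ))).exists
  exact ⟨s, hs'.1, hs'.2, hs (hX.smul (IsSelfAdjoint.all s))⟩

lemma Matrix.PosDef.eventually_loewner_near {α : Type*} {l : Filter α} {F : α → Matrix ι ι ℝ}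
    {Y : Matrix ι ι ℝ} (hY : Y.PosDef) (hF : ∀ a, (F a).IsHermitian)
    (hlim : Tendsto F l (nhds Y)) {ε : ℝ} (hε : 0 < ε) :
    ∀ᶠ a in l, (1 - ε) • Y ≤ F a ∧ F a ≤ (1 + ε) • Y := by
  have h := (hY.smul hε).eventually_isHermitian_imp_le
  have h1 : Tendsto (fun a => F a - Y) l (nhds 0) := by simpa using hlim.sub_const Y
  have h2 : Tendsto (fun a => Y - F a) l (nhds 0) := by simpa using hlim.const_sub Y
  filter_upwards [h1.eventually h, h2.eventually h] with a ha hb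
  have ha' := ha ((hF a).sub hY.isHermitian)
  have hb' := hb (hY.isHermitian.sub (hF a))
  rw [Matrix.le_iff] at ha' hb' ⊢
  refine ⟨?_, ?_⟩
  · convert hb' using 1
    module
  · rw [Matrix.le_iff]
    convert ha' using 1
    module

lemma Matrix.PosDef.tendsto_of_eventually_loewner {α : Type*} {l : Filter α}
    {F : α → Matrix ι ι ℝ} {Y : Matrix ι ι ℝ} (hY : Y.PosDef) (hF : ∀ a, (F a).IsHermitian)
    (h : ∀ ε : ℝ, 0 < ε → ε < 1 → ∀ᶠ a in l, (1 - ε) • Y ≤ F a ∧ F a ≤ (1 + ε) • Y) :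
    Tendsto F l (nhds Y) := by
  refine tendsto_pi_nhds.mpr fun i => tendsto_pi_nhds.mpr fun j => ?_
  rw [Metric.tendsto_nhds]
  intro δ hδ
  set c := (Y i i + Y j j) / 2 with hc
  have hc0 : 0 ≤ c := by
    have := hY.posSemidef.diag_nonneg (i := i)
    have := hY.posSemidef.diag_nonneg (i := j)
    positivity
  obtain ⟨ε, hε, hε1⟩ := exists_between (lt_min one_pos (show 0 < δ / (c + 1) by positivity))
  rw [lt_min_iff, lt_div_iff₀ (by positivity)] at hε1
  filter_upwards [h ε hε hε1.1] with a ⟨ha, hb⟩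
  have key := Matrix.abs_apply_le_of_loewner (D := F a - Y) (B := ε • Y)
    ((hF a).sub hY.isHermitian) (hY.smul hε).isHermitian
    (by rw [Matrix.le_iff] at ha ⊢; convert ha using 1; module)
    (by rw [Matrix.le_iff] at hb ⊢; convert hb using 1; module) i j
  simp only [sub_apply, smul_apply, smul_eq_mul] at key
  rw [Real.dist_eq]
  nlinarith

variable [DecidableEq ι] [DecidableEq κ]

lemma Matrix.PosDef.inv_le_inv_s14 {X Y : Matrix ι ι ℝ} (hX : X.PosDef) (hY : Y.PosDef)
    (h : X ≤ Y) : Y⁻¹ ≤ X⁻¹ := by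
  have hXu : IsUnit X.det := (Matrix.isUnit_iff_isUnit_det X).mp hX.isUnit
  have hYu : IsUnit Y.det := (Matrix.isUnit_iff_isUnit_det Y).mp hY.isUnit
  rw [Matrix.le_iff] at h ⊢
  have h1 := h.mul_mul_conjTranspose_same Y⁻¹
  have h2 := hX.posSemidef.mul_mul_conjTranspose_same (Y⁻¹ - X⁻¹)
  rw [hY.inv.isHermitian.eq] at h1
  rw [(hY.inv.isHermitian.sub hX.inv.isHermitian).eq] at h2
  convert h1.add h2 using 1
  simp only [sub_mul, mul_sub, Matrix.nonsing_inv_mul _ hXu, Matrix.nonsing_inv_mul _ hYu,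
    one_mul, Matrix.mul_nonsing_inv_cancel_right _ _ hXu]
  abel

lemma Matrix.PosDef.inv_smul_real {M : Matrix ι ι ℝ} (hM : M.PosDef) {s : ℝ} (hs : s ≠ 0) :
    (s • M)⁻¹ = s⁻¹ • M⁻¹ := by
  have := invertibleOfNonzero hs
  rw [Matrix.inv_smul _ s ((Matrix.isUnit_iff_isUnit_det M).mp hM.isUnit), invOf_eq_inv]

/-- The map `(X, R) ↦ A (X⁻¹ + Cᵀ R⁻¹ C)⁻¹ Aᵀ` is monotone and homogeneous of degree one. -/
lemma Matrix.riccati_le_smul (A : Matrix ι ι ℝ) (C : Matrix κ ι ℝ) {X Y : Matrix ι ι ℝ}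
    {R S : Matrix κ κ ℝ} (hX : X.PosDef) (hY : Y.PosDef) (hR : R.PosDef) (hS : S.PosDef)
    {t : ℝ} (ht : 0 < t) (hXY : X ≤ t • Y) (hRS : R ≤ t • S) :
    A * (X⁻¹ + Cᵀ * R⁻¹ * C)⁻¹ * Aᵀ ≤ t • (A * (Y⁻¹ + Cᵀ * S⁻¹ * C)⁻¹ * Aᵀ) := by
  have hpd {X' : Matrix ι ι ℝ} {R' : Matrix κ κ ℝ} (hX' : X'.PosDef) (hR' : R'.PosDef) :
      (X'⁻¹ + Cᵀ * R'⁻¹ * C).PosDef :=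
    hX'.inv.add_posSemidef (by simpa using hR'.inv.posSemidef.conjTranspose_mul_mul_same C)
  have h1 : t⁻¹ • Y⁻¹ ≤ X⁻¹ := hY.inv_smul_real ht.ne' ▸ hX.inv_le_inv_s14 (hY.smul ht) hXY
  have h2 : t⁻¹ • S⁻¹ ≤ R⁻¹ := hS.inv_smul_real ht.ne' ▸ hR.inv_le_inv_s14 (hS.smul ht) hRS
  have h3 : t⁻¹ • (Y⁻¹ + Cᵀ * S⁻¹ * C) ≤ X⁻¹ + Cᵀ * R⁻¹ * C := by
    simpa [smul_add] using add_le_add h1 (Matrix.transpose_mul_mul_mono C h2)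
  have ht' := inv_pos.mpr ht
  have h4 := ((hpd hY hS).smul ht').inv_le_inv_s14 (hpd hX hR) h3
  rw [(hpd hY hS).inv_smul_real ht'.ne', inv_inv] at h4
  simpa using Matrix.mul_mul_transpose_mono A h4

lemma Matrix.posDef_riccati (A : Matrix ι ι ℝ) (C : Matrix κ ι ℝ) {Q X : Matrix ι ι ℝ}
    {R : Matrix κ κ ℝ} (hX : X.PosDef) (hR : R.PosDef) (hQ : Q.PosDef) :
    (A * (X⁻¹ + Cᵀ * R⁻¹ * C)⁻¹ * Aᵀ + Q).PosDef := by
  have h1 : (X⁻¹ + Cᵀ * R⁻¹ * C).PosDef :=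
    hX.inv.add_posSemidef (by simpa using hR.inv.posSemidef.conjTranspose_mul_mul_same C)
  exact hQ.posSemidef_add (by simpa using h1.inv.posSemidef.mul_mul_conjTranspose_same A)

variable {A Q P X : Matrix ι ι ℝ} {C : Matrix κ ι ℝ} {R S : Matrix κ κ ℝ} {θ u : ℝ}

/-- One Riccati step contracts an upper bound relative to the fixed point `P`. -/
lemma Matrix.riccati_step_upper (hP : P.PosDef) (hX : X.PosDef) (hR : R.PosDef) (hS : S.PosDef)
    (heq : P = A * (P⁻¹ + Cᵀ * R⁻¹ * C)⁻¹ * Aᵀ + Q) (hθ : θ • P ≤ Q) (hu : 0 ≤ u)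
    (hXP : X ≤ (1 + u) • P) (hSR : S ≤ (1 + u) • R) :
    A * (X⁻¹ + Cᵀ * S⁻¹ * C)⁻¹ * Aᵀ + Q ≤ (1 + (1 - θ) * u) • P := by
  have h1 := Matrix.riccati_le_smul A C hX hP hS hR (by linarith) hXP hSR
  rw [eq_sub_iff_add_eq.mpr heq.symm] at h1
  have h2 := Matrix.smul_le_smul_of_le_s14 hθ hu
  rw [Matrix.le_iff] at h1 h2 ⊢
  convert h1.add h2 using 1
  module

/-- One Riccati step contracts a lower bound relative to the fixed point `P`. -/
lemma Matrix.riccati_step_lower (hP : P.PosDef) (hX : X.PosDef) (hR : R.PosDef) (hS : S.PosDef)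
    (heq : P = A * (P⁻¹ + Cᵀ * R⁻¹ * C)⁻¹ * Aᵀ + Q) (hθ : θ • P ≤ Q) (hu : 0 ≤ u) (hu1 : u < 1)
    (hXP : (1 - u) • P ≤ X) (hSR : (1 - u) • R ≤ S) :
    (1 - (1 - θ) * u) • P ≤ A * (X⁻¹ + Cᵀ * S⁻¹ * C)⁻¹ * Aᵀ + Q := by
  have hs : 0 < 1 - u := by linarith
  have h1 := Matrix.smul_le_smul_of_le_s14
    (Matrix.riccati_le_smul A C hP hX hR hS (inv_pos.mpr hs) (Matrix.le_inv_smul_of_smul_le hs hXP)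
      (Matrix.le_inv_smul_of_smul_le hs hSR)) hs.le
  rw [smul_smul, mul_inv_cancel₀ hs.ne', one_smul, eq_sub_iff_add_eq.mpr heq.symm] at h1
  have h2 := Matrix.smul_le_smul_of_le_s14 hθ hu
  rw [Matrix.le_iff] at h1 h2 ⊢
  convert h1.add h2 using 1
  module

lemma eventually_pow_mul_le {r : ℝ} (h0 : 0 ≤ r) (h1 : r < 1) (u : ℝ) {ε : ℝ} (hε : 0 < ε) :
    ∀ᶠ k in atTop, r ^ k * u ≤ ε := by
  have := (tendsto_pow_atTop_nhds_zero_of_lt_one h0 h1).mul_const u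
  rw [zero_mul] at this
  exact this.eventually_le_const hε

lemma mul_max_pow_le {r ε u : ℝ} (h0 : 0 ≤ r) (h1 : r ≤ 1) (hε : 0 ≤ ε) (k : ℕ) :
    r * max ε (r ^ k * u) ≤ max ε (r ^ (k + 1) * u) := by
  rw [mul_max_of_nonneg _ _ h0, pow_succ', mul_assoc]
  exact max_le_max_right _ (mul_le_of_le_one_left hε h1)

end LoewnerOrder

/-- for observable `(A, C)`, positive definite `Q`, and positive definite
`R_k → R` with `R` positive definite, the recursion
`P_{k+1} = A(P_k⁻¹ + Cᵀ R_k⁻¹ C)⁻¹ Aᵀ + Q` converges, from any positive definite `P_0`,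
to the unique positive definite solution `P` of `P = A(P⁻¹ + Cᵀ R⁻¹ C)⁻¹ Aᵀ + Q`. -/
theorem darr_convergent_parameter {n m : ℕ}
    (A : Matrix (Fin n) (Fin n) ℝ) (C : Matrix (Fin m) (Fin n) ℝ)
    (hobs : ∀ x : Fin n → ℝ, (∀ k : ℕ, C.mulVec ((A ^ k).mulVec x) = 0) → x = 0)
    (Q : Matrix (Fin n) (Fin n) ℝ) (hQ : Q.PosDef)
    (R : ℕ → Matrix (Fin m) (Fin m) ℝ) (hRk : ∀ k, (R k).PosDef)
    (Rlim : Matrix (Fin m) (Fin m) ℝ) (hRlim : Rlim.PosDef)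
    (hRconv : Tendsto R atTop (nhds Rlim))
    (Pseq : ℕ → Matrix (Fin n) (Fin n) ℝ) (hP0 : (Pseq 0).PosDef)
    (hrec : ∀ k, Pseq (k + 1) = A * ((Pseq k)⁻¹ + Cᵀ * (R k)⁻¹ * C)⁻¹ * Aᵀ + Q)
    (P : Matrix (Fin n) (Fin n) ℝ) (hP : P.PosDef)
    (heq : P = A * (P⁻¹ + Cᵀ * Rlim⁻¹ * C)⁻¹ * Aᵀ + Q) :
    Tendsto Pseq atTop (nhds P) := by
  open scoped MatrixOrder in
  have hpos : ∀ k, (Pseq k).PosDef := fun k => by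
    induction k with
    | zero => exact hP0
    | succ k ih => exact hrec k ▸ Matrix.posDef_riccati A C ih (hRk k) hQ
  refine hP.tendsto_of_eventually_loewner (fun k => (hpos k).isHermitian) fun ε hε hε1 => ?_
  obtain ⟨θ, hθ0, hθ1, hθ⟩ := hQ.exists_pos_smul_le hP.isHermitian
  obtain ⟨N, hN⟩ := eventually_atTop.mp
    (hRlim.eventually_loewner_near (fun k => (hRk k).isHermitian) hRconv hε)
  obtain ⟨s, hs0, hs1, hs⟩ := hP.exists_pos_smul_le (hpos N).isHermitian
  obtain ⟨v, hv0, hv1, hv⟩ := (hpos N).exists_pos_smul_le hP.isHermitian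
  have hr0 : 0 ≤ 1 - θ := by linarith
  have hr1 : 1 - θ < 1 := by linarith
  have upper : ∀ k, Pseq (N + k) ≤ (1 + max ε ((1 - θ) ^ k * s⁻¹)) • P := fun k => by
    induction k with
    | zero =>
      refine (Matrix.le_inv_smul_of_smul_le hs0 hs).trans
        (Matrix.smul_le_smul_of_posSemidef hP.posSemidef ?_)
      rw [pow_zero, one_mul]
      linarith [le_max_right ε s⁻¹]
    | succ k ih =>
      rw [← add_assoc, hrec]
      refine (Matrix.riccati_step_upper hP (hpos _) hRlim (hRk _) heq hθ
        (hε.le.trans (le_max_left _ _)) ih ((hN _ (Nat.le_add_right N k)).2.trans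
          (Matrix.smul_le_smul_of_posSemidef hRlim.posSemidef ?_))).trans
        (Matrix.smul_le_smul_of_posSemidef hP.posSemidef ?_)
      · linarith [le_max_left ε ((1 - θ) ^ k * s⁻¹)]
      · linarith [mul_max_pow_le (u := s⁻¹) hr0 hr1.le hε.le k]
  have lower : ∀ k, (1 - max ε ((1 - θ) ^ k * (1 - v))) • P ≤ Pseq (N + k) := fun k => by
    induction k with
    | zero =>
      refine (Matrix.smul_le_smul_of_posSemidef hP.posSemidef ?_).trans hv
      rw [pow_zero, one_mul]
      linarith [le_max_right ε (1 - v)]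
    | succ k ih =>
      rw [← add_assoc, hrec]
      refine (Matrix.smul_le_smul_of_posSemidef hP.posSemidef ?_).trans
        (Matrix.riccati_step_lower hP (hpos _) hRlim (hRk _) heq hθ
        (hε.le.trans (le_max_left _ _)) (max_lt hε1 ?_) ih
        ((Matrix.smul_le_smul_of_posSemidef hRlim.posSemidef ?_).trans
          (hN _ (Nat.le_add_right N k)).1))
      · linarith [mul_max_pow_le (u := 1 - v) hr0 hr1.le hε.le k]
      · nlinarith [pow_le_one₀ (n := k) hr0 hr1.le, pow_nonneg hr0 k]
      · linarith [le_max_left ε ((1 - θ) ^ k * (1 - v))]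
  obtain ⟨K, hK⟩ := eventually_atTop.mp
    ((eventually_pow_mul_le hr0 hr1 s⁻¹ hε).and (eventually_pow_mul_le hr0 hr1 (1 - v) hε))
  filter_upwards [eventually_ge_atTop (N + K)] with k hk
  obtain ⟨j, rfl⟩ := Nat.exists_eq_add_of_le (show N ≤ k by omega)
  obtain ⟨hj1, hj2⟩ := hK j (by omega)
  have hl := lower j
  have hu := upper j
  rw [max_eq_left hj1] at hu
  rw [max_eq_left hj2] at hl
  exact ⟨hl, hu⟩
end
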